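/- Let G be a subcubic graph and L a 10-edge list assignment. If G has no strong L-edge-coloring but every proper subgraph of G has one, then G contains no cycle of length at most 5 (in particular G has girth at least 6). -/

import Mathlib

/-- Two distinct edges of `G` conflict (are at distance at most 2) if they share an
endpoint or are joined by a common edge. -/
def edgeConflict {V : Type*} (G : SimpleGraph V) (e f : Sym2 V) : Prop :=
  e ≠ f ∧ ((∃ v, v ∈ e ∧ v ∈ f) ∨
    ∃ g ∈ G.edgeSet, (∃ v, v ∈ e ∧ v ∈ g) ∧ (∃ v, v ∈ g ∧ v ∈ f))

/-- `φ` is a strong edge coloring of `G`: edges at distance at most 2 get distinct colors. -/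
def IsStrongEdgeColoring {V : Type*} (G : SimpleGraph V) (φ : Sym2 V → ℕ) : Prop :=
  ∀ e ∈ G.edgeSet, ∀ f ∈ G.edgeSet, edgeConflict G e f → φ e ≠ φ f

/-- `φ` is a strong edge coloring of `G` from the lists `L`. -/
def IsStrongListColoring {V : Type*} (G : SimpleGraph V) (L : Sym2 V → Finset ℕ)
    (φ : Sym2 V → ℕ) : Prop :=
  IsStrongEdgeColoring G φ ∧ ∀ e ∈ G.edgeSet, φ e ∈ L e

/-- `G` is strongly `k`-edge choosable. -/
def StronglyEdgeChoosable {V : Type*} (G : SimpleGraph V) (k : ℕ) : Prop :=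
  ∀ L : Sym2 V → Finset ℕ, (∀ e ∈ G.edgeSet, k ≤ (L e).card) →
    ∃ φ, IsStrongListColoring G L φ

/-- `ψ` colors the vertices of `U` from the lists `L`, properly with respect to `R`. -/
def IsProperOn {ι : Type*} (R : ι → ι → Prop) (U : Finset ι) (L : ι → Finset ℕ)
    (ψ : ι → ℕ) : Prop :=
  (∀ i ∈ U, ψ i ∈ L i) ∧ ∀ i ∈ U, ∀ j ∈ U, i ≠ j → R i j → ψ i ≠ ψ j

/-- The relation `R` on `U` can be properly colored from any lists of sizes at least `f`. -/
def ChoosableOn {ι : Type*} (R : ι → ι → Prop) (U : Finset ι) (f : ι → ℕ) : Prop :=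
  ∀ L : ι → Finset ℕ, (∀ i ∈ U, f i ≤ (L i).card) → ∃ ψ, IsProperOn R U L ψ

section Choosability

variable {ι : Type*} [DecidableEq ι] {R : ι → ι → Prop} {U : Finset ι} {f : ι → ℕ}

theorem ChoosableOn.mono {U' : Finset ι} {f' : ι → ℕ} (h : ChoosableOn R U f) (hU : U' ⊆ U)
    (hf : ∀ i ∈ U', f i ≤ f' i) : ChoosableOn R U' f' := by
  intro L hL
  obtain ⟨P, hP⟩ : ∃ P : Finset ℕ, P.card = U.sup f := Infinite.exists_subset_card_eq ℕ _
  obtain ⟨ψ, h1, h2⟩ := h (fun i => if i ∈ U' then L i else P) (by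
    intro i hi
    by_cases hi' : i ∈ U'
    · simpa [hi'] using (hf i hi').trans (hL i hi')
    · simpa [hi', hP] using Finset.le_sup (f := f) hi)
  refine ⟨ψ, fun i hi => ?_, fun i hi j hj => h2 i (hU hi) j (hU hj)⟩
  simpa [hi] using h1 i (hU hi)

/-- A vertex with fewer neighbors than available colors may be colored last. -/
theorem ChoosableOn.insert_of_card_lt (hR : ∀ i j, R i j → R j i) (h : ChoosableOn R U f) (x : ι)
    (W : Finset ι) (hW : ∀ j ∈ U, R x j → j ∈ W) (hx : W.card < f x) :
    ChoosableOn R (insert x U) f := by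
  intro L hL
  by_cases hxU : x ∈ U
  · rw [Finset.insert_eq_of_mem hxU] at hL ⊢
    exact h L hL
  obtain ⟨ψ, h1, h2⟩ := h L (fun i hi => hL i (Finset.mem_insert_of_mem hi))
  obtain ⟨c, hc, hcW⟩ : ∃ c ∈ L x, c ∉ W.image ψ := by
    apply Finset.exists_mem_notMem_of_card_lt_card
    exact (Finset.card_image_le.trans_lt hx).trans_le (hL x (Finset.mem_insert_self _ _))
  have hcj : ∀ j ∈ U, R x j → c ≠ ψ j := fun j hj hxj hcj =>
    hcW (Finset.mem_image.2 ⟨j, hW j hj hxj, hcj.symm⟩)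
  have hne : ∀ i ∈ U, i ≠ x := fun i hi hix => hxU (hix ▸ hi)
  refine ⟨Function.update ψ x c, ?_, ?_⟩
  · intro i hi
    rcases Finset.mem_insert.1 hi with rfl | hi
    · simpa using hc
    · simpa [hne i hi] using h1 i hi
  · intro i hi j hj hij hRij
    rcases Finset.mem_insert.1 hi with hi' | hi' <;> rcases Finset.mem_insert.1 hj with hj' | hj'
    · exact absurd (hi'.trans hj'.symm) hij
    · subst hi'
      simpa [hne j hj'] using hcj j hj' hRij
    · subst hj'
      simpa [hne i hi'] using (hcj i hi' (hR _ _ hRij)).symm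
    · simpa [hne i hi', hne j hj'] using h2 i hi' j hj' hij hRij

/-- Greedy coloring along a list, the last vertex of the list being colored first. -/
theorem choosableOn_of_list (hR : ∀ i j, R i j → R j i) (l : List ι)
    (hl : ∀ t ∈ l.tails, ∀ i ∈ t.head?, t.length ≤ f i) : ChoosableOn R l.toFinset f := by
  induction l with
  | nil => exact fun _ _ => ⟨fun _ => 0, by simp, by simp⟩
  | cons x l ih =>
    rw [List.toFinset_cons]
    refine (ih fun t ht => hl t (by simp_all)).insert_of_card_lt hR x l.toFinset (fun j hj _ => hj) ?_
    exact (List.toFinset_card_le l).trans_lt (by simpa using hl (x :: l) (by simp) x (by simp))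

theorem choosableOn_of_card_le (hR : ∀ i j, R i j → R j i) (h : ∀ i ∈ U, U.card ≤ f i) :
    ChoosableOn R U f := by
  rw [← U.toList_toFinset]
  refine choosableOn_of_list hR _ fun t ht i hi => ?_
  have ht' := (List.mem_tails _ _).1 ht
  have := h i (Finset.mem_toList.1 (ht'.subset (List.mem_of_mem_head? hi)))
  exact (by simpa using ht'.length_le : t.length ≤ U.card).trans this

/-- Small pot lemma: when every list may be assumed shorter than `U.card`, it suffices to
consider lists whose union has fewer than `U.card` colors. -/
theorem choosableOn_of_small_pot (hf : ∀ i ∈ U, f i < U.card)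
    (h : ∀ L : ι → Finset ℕ, (∀ i ∈ U, f i ≤ (L i).card) → (U.biUnion L).card < U.card →
      ∃ ψ, IsProperOn R U L ψ) : ChoosableOn R U f := by
  intro L hL
  obtain ⟨S, hS, hmax⟩ := (U.powerset.filter fun S =>
    S = ∅ ∨ (S.biUnion L).card < S.card).exists_max_image Finset.card ⟨∅, by simp⟩
  simp only [Finset.mem_filter, Finset.mem_powerset] at hS hmax
  obtain ⟨hSU, hS⟩ := hS
  have hSle : (S.biUnion L).card ≤ S.card := by
    rcases hS with rfl | hS
    · simp
    · exact hS.le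
  obtain ⟨g, hg, hgL⟩ := (Finset.all_card_le_biUnion_card_iff_exists_injective
    fun i : {i // i ∈ U \ S} => L i \ S.biUnion L).1 (by
      intro s
      rcases s.eq_empty_or_nonempty with rfl | ⟨i₀, hi₀⟩
      · simp
      set s' : Finset ι := s.map (Function.Embedding.subtype _) with hs'
      have hs'U : s' ⊆ U \ S := by
        intro i hi
        obtain ⟨j, _, rfl⟩ := Finset.mem_map.1 hi
        exact j.2
      have hdisj : Disjoint S s' :=
        Finset.disjoint_left.2 fun i hi hi' => (Finset.mem_sdiff.1 (hs'U hi')).2 hi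
      have hcard : s'.card = s.card := Finset.card_map _
      have hpos : 0 < s.card := Finset.card_pos.2 ⟨i₀, hi₀⟩
      have hun : (S ∪ s').card = S.card + s.card := by
        rw [Finset.card_union_of_disjoint hdisj, hcard]
      have hbig : (S ∪ s').card ≤ ((S ∪ s').biUnion L).card := by
        by_contra hlt
        have := hmax (S ∪ s') ⟨Finset.union_subset hSU
          (hs'U.trans Finset.sdiff_subset), Or.inr (not_le.1 hlt)⟩
        omega
      have hsub : (S ∪ s').biUnion L ⊆
          S.biUnion L ∪ s.biUnion fun i => L i \ S.biUnion L := by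
        intro c hc
        by_cases hcS : c ∈ S.biUnion L
        · exact Finset.mem_union_left _ hcS
        obtain ⟨i, hi, hci⟩ := Finset.mem_biUnion.1 hc
        rcases Finset.mem_union.1 hi with hi | hi
        · exact absurd (Finset.mem_biUnion.2 ⟨i, hi, hci⟩) hcS
        obtain ⟨j, hj, rfl⟩ := Finset.mem_map.1 hi
        exact Finset.mem_union_right _
          (Finset.mem_biUnion.2 ⟨j, hj, Finset.mem_sdiff.2 ⟨hci, hcS⟩⟩)
      have := (Finset.card_le_card hsub).trans (Finset.card_union_le _ _)
      omega)
  obtain ⟨ψ, hψ⟩ : ∃ ψ, IsProperOn R S L ψ := by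
    rcases hS with rfl | hS
    · exact ⟨fun _ => 0, by simp, by simp⟩
    have hSc := Finset.card_le_card hSU
    obtain ⟨P, hLP, hP⟩ := Infinite.exists_superset_card_eq (S.biUnion L) (U.card - 1) (by omega)
    obtain ⟨ψ, h1, h2⟩ := h (fun i => if i ∈ S then L i else P) (by
      intro i hi
      by_cases hiS : i ∈ S
      · simpa [hiS] using hL i hi
      · have := hf i hi
        simp only [hiS, if_false]
        omega) (by
      have : U.biUnion (fun i => if i ∈ S then L i else P) ⊆ P := by
        intro c hc
        obtain ⟨i, _, hci⟩ := Finset.mem_biUnion.1 hc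
        by_cases hiS : i ∈ S
        · exact hLP (Finset.mem_biUnion.2 ⟨i, hiS, by simpa [hiS] using hci⟩)
        · simpa [hiS] using hci
      have := Finset.card_le_card this
      omega)
    refine ⟨ψ, fun i hi => ?_, fun i hi j hj => h2 i (hSU hi) j (hSU hj)⟩
    simpa [hi] using h1 i (hSU hi)
  obtain ⟨h1, h2⟩ := hψ
  have hgL' : ∀ i (hi : i ∈ U \ S), g ⟨i, hi⟩ ∈ L i ∧ g ⟨i, hi⟩ ∉ S.biUnion L :=
    fun i hi => Finset.mem_sdiff.1 (hgL ⟨i, hi⟩)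
  refine ⟨fun i => if hi : i ∈ U \ S then g ⟨i, hi⟩ else ψ i, ?_, ?_⟩
  · intro i hi
    by_cases hiS : i ∈ U \ S
    · simpa only [hiS, dif_pos] using (hgL' i hiS).1
    · simpa only [hiS, dif_neg, not_false_eq_true] using h1 i (by simp_all)
  · intro i hi j hj hij hRij
    by_cases hiS : i ∈ U \ S <;> by_cases hjS : j ∈ U \ S
    · simp only [hiS, hjS, dif_pos]
      intro he
      exact hij (congrArg Subtype.val (hg he))
    · simp only [hiS, hjS, dif_pos, dif_neg, not_false_eq_true]
      have hjS' : j ∈ S := by simp_all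
      intro he
      exact (hgL' i hiS).2 (he ▸ Finset.mem_biUnion.2 ⟨j, hjS', h1 j hjS'⟩)
    · simp only [hiS, hjS, dif_pos, dif_neg, not_false_eq_true]
      have hiS' : i ∈ S := by simp_all
      intro he
      exact (hgL' j hjS).2 (he ▸ Finset.mem_biUnion.2 ⟨i, hiS', h1 i hiS'⟩)
    · simp only [hiS, hjS, dif_neg, not_false_eq_true]
      exact h2 i (by simp_all) j (by simp_all) hij hRij

/-- Two nonadjacent vertices with a common color `c` may both be colored `c`. -/
theorem ChoosableOn.exists_isProperOn_of_common {x y : ι} (hR : ∀ i j, R i j → R j i)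
    (hxy : ¬ R x y) {L : ι → Finset ℕ} (hL : ∀ i ∈ U, f i ≤ (L i).card) {c : ℕ}
    (hcx : c ∈ L x) (hcy : c ∈ L y) (h : ChoosableOn R (U \ {x, y}) fun i => f i - 1) :
    ∃ ψ, IsProperOn R U L ψ := by
  obtain ⟨ψ, h1, h2⟩ := h (fun i => (L i).erase c) (by
    intro i hi
    have := hL i (Finset.mem_sdiff.1 hi).1
    have := Finset.pred_card_le_card_erase (s := L i) (a := c)
    dsimp only
    omega)
  have hmem : ∀ i ∈ U, ¬ (i = x ∨ i = y) → i ∈ U \ {x, y} := fun i hi hi' => by simp [hi, hi']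
  refine ⟨fun i => if i = x ∨ i = y then c else ψ i, fun i hi => ?_, fun i hi j hj hij hRij => ?_⟩
  · by_cases hi' : i = x ∨ i = y
    · simp only [hi', if_true]
      rcases hi' with rfl | rfl <;> assumption
    · simpa only [hi', if_false] using Finset.mem_of_mem_erase (h1 i (hmem i hi hi'))
  · by_cases hi' : i = x ∨ i = y <;> by_cases hj' : j = x ∨ j = y
    · exfalso
      rcases hi' with rfl | rfl <;> rcases hj' with rfl | rfl
      exacts [hij rfl, hxy hRij, hxy (hR _ _ hRij), hij rfl]
    · simp only [hi', hj', if_true, if_false]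
      exact (Finset.ne_of_mem_erase (h1 j (hmem j hj hj'))).symm
    · simp only [hi', hj', if_true, if_false]
      exact Finset.ne_of_mem_erase (h1 i (hmem i hi hi'))
    · simp only [hi', hj', if_false]
      exact h2 i (hmem i hi hi') j (hmem j hj hj') hij hRij

/-- Two nonadjacent vertices whose lists have at least `U.card` colors in total may be
given a common color. -/
theorem ChoosableOn.of_pair (hR : ∀ i j, R i j → R j i) (x y : ι) (hxy : ¬ R x y)
    (h : ChoosableOn R (U \ {x, y}) fun i => f i - 1) (hx : x ∈ U) (hy : y ∈ U)
    (hf : ∀ i ∈ U, f i < U.card) (hsum : U.card ≤ f x + f y) : ChoosableOn R U f := by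
  refine choosableOn_of_small_pot hf fun L hL hpot => ?_
  obtain ⟨c, hc⟩ : (L x ∩ L y).Nonempty := by
    by_contra hne
    have hun := Finset.card_union_add_card_inter (L x) (L y)
    rw [Finset.not_nonempty_iff_eq_empty.1 hne, Finset.card_empty] at hun
    have := Finset.card_le_card (Finset.union_subset (Finset.subset_biUnion_of_mem L hx)
      (Finset.subset_biUnion_of_mem L hy))
    have := hL x hx
    have := hL y hy
    omega
  exact h.exists_isProperOn_of_common hR hxy hL (Finset.mem_inter.1 hc).1 (Finset.mem_inter.1 hc).2

/-- Among three pairwise nonadjacent vertices whose lists have at least `U.card` colors in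
total, some two may be given a common color. -/
theorem ChoosableOn.of_triple (hR : ∀ i j, R i j → R j i) (x y z : ι) (hxy : ¬ R x y)
    (hxz : ¬ R x z) (hyz : ¬ R y z)
    (h₁ : ChoosableOn R (U \ {x, y}) fun i => f i - 1)
    (h₂ : ChoosableOn R (U \ {x, z}) fun i => f i - 1)
    (h₃ : ChoosableOn R (U \ {y, z}) fun i => f i - 1) (hx : x ∈ U) (hy : y ∈ U) (hz : z ∈ U)
    (hf : ∀ i ∈ U, f i < U.card) (hsum : U.card ≤ f x + f y + f z) : ChoosableOn R U f := by
  refine choosableOn_of_small_pot hf fun L hL hpot => ?_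
  by_cases hc₁ : ∃ c, c ∈ L x ∧ c ∈ L y
  · obtain ⟨c, hc⟩ := hc₁
    exact h₁.exists_isProperOn_of_common hR hxy hL hc.1 hc.2
  by_cases hc₂ : ∃ c, c ∈ L x ∧ c ∈ L z
  · obtain ⟨c, hc⟩ := hc₂
    exact h₂.exists_isProperOn_of_common hR hxz hL hc.1 hc.2
  by_cases hc₃ : ∃ c, c ∈ L y ∧ c ∈ L z
  · obtain ⟨c, hc⟩ := hc₃
    exact h₃.exists_isProperOn_of_common hR hyz hL hc.1 hc.2
  exfalso
  have hd₁ : Disjoint (L x) (L y) := Finset.disjoint_left.2 fun c h h' => hc₁ ⟨c, h, h'⟩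
  have hd₂ : Disjoint (L x ∪ L y) (L z) := Finset.disjoint_left.2 fun c h h' =>
    (Finset.mem_union.1 h).elim (fun h => hc₂ ⟨c, h, h'⟩) fun h => hc₃ ⟨c, h, h'⟩
  have := Finset.card_union_of_disjoint hd₁
  have := Finset.card_union_of_disjoint hd₂
  have := Finset.card_le_card (Finset.union_subset (Finset.union_subset
    (Finset.subset_biUnion_of_mem L hx) (Finset.subset_biUnion_of_mem L hy))
    (Finset.subset_biUnion_of_mem L hz))
  have := hL x hx
  have := hL y hy
  have := hL z hz
  omega

end Choosability

section SmallGraphs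

theorem choosableOn_of_toFinset {ι : Type*} [DecidableEq ι] {R : ι → ι → Prop} {U : Finset ι}
    {f : ι → ℕ} (hR : ∀ i j, R i j → R j i) (l : List ι) (hU : U = l.toFinset)
    (hl : ∀ t ∈ l.tails, ∀ i ∈ t.head?, t.length ≤ f i) : ChoosableOn R U f :=
  hU ▸ choosableOn_of_list hR l hl

theorem choosableOn_two_three {R : Fin 9 → Fin 9 → Prop} (hR : ∀ i j, R i j → R j i)
    (h₁ : ¬ R 6 7) (h₂ : ¬ R 6 8) (h₃ : ¬ R 7 8) :
    ChoosableOn R Finset.univ ![8, 8, 8, 8, 8, 8, 4, 4, 4] := by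
  refine .of_triple hR 6 7 8 h₁ h₂ h₃ ?_ ?_ ?_ (by decide) (by decide) (by decide) (by decide)
    (by decide)
  · exact choosableOn_of_toFinset hR [0, 1, 2, 3, 4, 5, 8] (by decide) (by decide)
  · exact choosableOn_of_toFinset hR [0, 1, 2, 3, 4, 5, 7] (by decide) (by decide)
  · exact choosableOn_of_toFinset hR [0, 1, 2, 3, 4, 5, 6] (by decide) (by decide)

theorem choosableOn_two_three' {R : Fin 9 → Fin 9 → Prop} (hR : ∀ i j, R i j → R j i)
    (h : ¬ R 6 8) : ChoosableOn R Finset.univ ![8, 8, 8, 8, 8, 8, 5, 5, 4] := by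
  refine .of_pair hR 6 8 h ?_ (by decide) (by decide) (by decide) (by decide)
  exact choosableOn_of_toFinset hR [0, 1, 2, 3, 4, 5, 7] (by decide) (by decide)

theorem choosableOn_ladder {R : Fin 7 → Fin 7 → Prop} (hR : ∀ i j, R i j → R j i)
    (h : ¬ R 2 6) : ChoosableOn R Finset.univ ![6, 5, 4, 5, 5, 5, 4] := by
  refine .of_pair hR 2 6 h ?_ (by decide) (by decide) (by decide) (by decide)
  exact choosableOn_of_toFinset hR [0, 1, 3, 4, 5] (by decide) (by decide)

theorem choosableOn_theta {R : Fin 11 → Fin 11 → Prop} (hR : ∀ i j, R i j → R j i)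
    (h₁ : ¬ R 0 8) (h₂ : ¬ R 1 7) (h₃ : ¬ R 6 9) (h₄ : ¬ R 6 10) (h₅ : ¬ R 9 10) :
    ChoosableOn R Finset.univ ![8, 8, 8, 8, 8, 8, 6, 4, 4, 4, 4] := by
  refine .of_pair hR 0 8 h₁ ?_ (by decide) (by decide) (by decide) (by decide)
  refine .of_pair hR 1 7 h₂ ?_ (by decide) (by decide) (by decide) (by decide)
  refine .of_triple hR 6 9 10 h₃ h₄ h₅ ?_ ?_ ?_ (by decide) (by decide) (by decide) (by decide)
    (by decide)
  · exact choosableOn_of_toFinset hR [2, 3, 4, 5, 10] (by decide) (by decide)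
  · exact choosableOn_of_toFinset hR [2, 3, 4, 5, 9] (by decide) (by decide)
  · exact choosableOn_of_toFinset hR [2, 3, 4, 5, 6] (by decide) (by decide)

theorem choosableOn_theta' {R : Fin 11 → Fin 11 → Prop} (hR : ∀ i j, R i j → R j i)
    (h₁ : ¬ R 0 8) (h₂ : ¬ R 1 7) (h₃ : ¬ R 6 9) :
    ChoosableOn R Finset.univ ![8, 8, 8, 8, 8, 8, 6, 4, 4, 5, 5] := by
  refine .of_pair hR 0 8 h₁ ?_ (by decide) (by decide) (by decide) (by decide)
  refine .of_pair hR 1 7 h₂ ?_ (by decide) (by decide) (by decide) (by decide)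
  refine .of_pair hR 6 9 h₃ ?_ (by decide) (by decide) (by decide) (by decide)
  exact choosableOn_of_toFinset hR [2, 3, 4, 5, 10] (by decide) (by decide)

theorem choosableOn_four_cycle {R : Fin 8 → Fin 8 → Prop} (hR : ∀ i j, R i j → R j i)
    (h₁ : ¬ R 4 6) (h₂ : ¬ R 5 7) : ChoosableOn R Finset.univ ![6, 6, 6, 6, 4, 4, 4, 4] := by
  refine .of_pair hR 4 6 h₁ ?_ (by decide) (by decide) (by decide) (by decide)
  refine .of_pair hR 5 7 h₂ ?_ (by decide) (by decide) (by decide) (by decide)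
  exact choosableOn_of_toFinset hR [0, 1, 2, 3] (by decide) (by decide)

theorem choosableOn_five_cycle {R : Fin 10 → Fin 10 → Prop} (hR : ∀ i j, R i j → R j i)
    (h₀ : ¬ R 0 8) (h₁ : ¬ R 1 9) (h₃ : ¬ R 3 6) (h₂ : ¬ R 2 5) (h₄ : ¬ R 4 7) (h₅ : ¬ R 5 7) :
    ChoosableOn R Finset.univ ![6, 6, 6, 6, 6, 4, 4, 4, 4, 4] := by
  refine .of_pair hR 0 8 h₀ ?_ (by decide) (by decide) (by decide) (by decide)
  refine .of_pair hR 1 9 h₁ ?_ (by decide) (by decide) (by decide) (by decide)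
  refine .of_pair hR 3 6 h₃ ?_ (by decide) (by decide) (by decide) (by decide)
  refine ((((choosableOn_of_toFinset (U := {5}) hR [5] (by decide) (by decide)).insert_of_card_lt
    hR 7 ∅ ?_ (by decide)).insert_of_card_lt hR 2 {7} ?_ (by decide)).insert_of_card_lt
    hR 4 {5, 2} ?_ (by decide)).mono (by decide) fun _ _ => le_rfl
  · simp [mt (hR 7 5) h₅]
  · simp [h₂]
  · simp [h₄]

theorem choosableOn_five_cycle' {R : Fin 10 → Fin 10 → Prop} (hR : ∀ i j, R i j → R j i)
    (h₀ : ¬ R 0 8) (h₁ : ¬ R 1 9) (h₃ : ¬ R 3 6) (h₂ : ¬ R 2 5) (h₄ : ¬ R 4 7) :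
    ChoosableOn R Finset.univ ![6, 6, 6, 6, 6, 5, 4, 5, 4, 4] := by
  refine .of_pair hR 0 8 h₀ ?_ (by decide) (by decide) (by decide) (by decide)
  refine .of_pair hR 1 9 h₁ ?_ (by decide) (by decide) (by decide) (by decide)
  refine .of_pair hR 3 6 h₃ ?_ (by decide) (by decide) (by decide) (by decide)
  refine (((choosableOn_of_toFinset (U := {7, 5}) hR [7, 5] (by decide) (by decide)
    ).insert_of_card_lt hR 2 {7} ?_ (by decide)).insert_of_card_lt
    hR 4 {5, 2} ?_ (by decide)).mono (by decide) fun _ _ => le_rfl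
  · simp [h₂]
  · simp [h₄]

end SmallGraphs

section Conflicts

variable {V : Type*} {G : SimpleGraph V}

theorem edgeConflict_mk {a b c d : V} : edgeConflict G s(a, b) s(c, d) ↔ s(a, b) ≠ s(c, d) ∧
    (a = c ∨ a = d ∨ b = c ∨ b = d ∨ G.Adj a c ∨ G.Adj a d ∨ G.Adj b c ∨ G.Adj b d) := by
  refine and_congr_right fun _ => ⟨?_, ?_⟩
  · rintro (⟨v, hv, hv'⟩ | ⟨g, hg, ⟨v, hv, hvg⟩, w, hwg, hw⟩)
    · simp only [Sym2.mem_iff] at hv hv'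
      grind
    · by_cases hvw : v = w
      · simp only [Sym2.mem_iff] at hv hw
        grind
      · obtain rfl : g = s(v, w) := (Sym2.mem_and_mem_iff hvw).1 ⟨hvg, hwg⟩
        simp only [Sym2.mem_iff] at hv hw
        rw [SimpleGraph.mem_edgeSet] at hg
        grind
  · have key : ∀ {x y : V}, x ∈ s(a, b) → y ∈ s(c, d) → G.Adj x y →
        ∃ g ∈ G.edgeSet, (∃ v, v ∈ s(a, b) ∧ v ∈ g) ∧ ∃ v, v ∈ g ∧ v ∈ s(c, d) :=
      fun {x y} hx hy h => ⟨s(x, y), h, ⟨x, hx, by simp⟩, y, by simp, hy⟩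
    rintro (rfl | rfl | rfl | rfl | h | h | h | h)
    · exact Or.inl ⟨a, by simp, by simp⟩
    · exact Or.inl ⟨a, by simp, by simp⟩
    · exact Or.inl ⟨b, by simp, by simp⟩
    · exact Or.inl ⟨b, by simp, by simp⟩
    all_goals exact Or.inr (key (by simp) (by simp) h)

theorem edgeConflict.symm {e f : Sym2 V} (h : edgeConflict G e f) : edgeConflict G f e := by
  induction e with | _ a b
  induction f with | _ c d
  rw [edgeConflict_mk] at h ⊢
  have := G.adj_comm
  grind

theorem edgeConflict.deleteIncidenceSet {v : V} {e f : Sym2 V} (h : edgeConflict G e f)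
    (he : v ∉ e) (hf : v ∉ f) : edgeConflict (G.deleteIncidenceSet v) e f := by
  induction e with | _ a b
  induction f with | _ c d
  rw [edgeConflict_mk] at h ⊢
  simp only [G.deleteIncidenceSet_adj]
  simp only [Sym2.mem_iff, not_or] at he hf
  have := he.1
  grind

open Classical in
/-- The edges at distance at most 2 from `e`. -/
noncomputable def conflicts [Fintype V] (G : SimpleGraph V) (e : Sym2 V) : Finset (Sym2 V) :=
  {f | f ∈ G.edgeSet ∧ edgeConflict G e f}

theorem mem_conflicts [Fintype V] {e f : Sym2 V} :
    f ∈ conflicts G e ↔ f ∈ G.edgeSet ∧ edgeConflict G e f := by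
  simp [conflicts]

variable [Fintype V] [DecidableEq V] [DecidableRel G.Adj]

theorem conflicts_subset {u v a b c d : V} (hu : ∀ x, G.Adj u x → x = v ∨ x = a ∨ x = b)
    (hv : ∀ x, G.Adj v x → x = u ∨ x = c ∨ x = d) :
    conflicts G s(u, v) ⊆ G.incidenceFinset a ∪ G.incidenceFinset b ∪ G.incidenceFinset c ∪
      G.incidenceFinset d := by
  intro f hf
  rw [mem_conflicts] at hf
  obtain ⟨hf, hc⟩ := hf
  induction f with | _ x y
  rw [edgeConflict_mk] at hc
  have hxy : G.Adj x y := hf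
  have hyx : G.Adj y x := hxy.symm
  obtain ⟨hne, hc⟩ := hc
  rw [Ne, Sym2.eq_iff] at hne
  simp only [Finset.mem_union, SimpleGraph.mem_incidenceFinset,
    SimpleGraph.incidenceSet, Set.mem_ofPred_eq, SimpleGraph.mem_edgeSet, hxy, true_and,
    Sym2.mem_iff]
  grind

theorem card_union_incidenceFinset_le (hG : ∀ v, G.degree v ≤ 3) (T : Finset (Sym2 V)) (z : V) :
    (T ∪ G.incidenceFinset z).card ≤ T.card + 3 :=
  (Finset.card_union_le _ _).trans (by
    rw [SimpleGraph.card_incidenceFinset_eq_degree]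
    exact Nat.add_le_add_left (hG z) _)

theorem card_union_incidenceFinset_le_of_mem (hG : ∀ v, G.degree v ≤ 3) {T : Finset (Sym2 V)}
    {z t : V} (hzt : G.Adj z t) (ht : G.incidenceFinset t ⊆ T) :
    (T ∪ G.incidenceFinset z).card ≤ T.card + 2 := by
  have h := Finset.card_union_add_card_inter T (G.incidenceFinset z)
  have : s(z, t) ∈ T ∩ G.incidenceFinset z :=
    Finset.mem_inter.2 ⟨ht (by simp [SimpleGraph.incidenceSet, hzt]),
      by simp [SimpleGraph.incidenceSet, hzt]⟩
  have := Finset.card_pos.2 ⟨_, this⟩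
  rw [SimpleGraph.card_incidenceFinset_eq_degree] at h
  have := hG z
  omega

theorem card_union_incidenceFinset_le_of_mem_of_mem (hG : ∀ v, G.degree v ≤ 3)
    {T : Finset (Sym2 V)} {z t t' : V} (hzt : G.Adj z t) (hzt' : G.Adj z t') (htt' : t ≠ t')
    (ht : G.incidenceFinset t ⊆ T) (ht' : G.incidenceFinset t' ⊆ T) :
    (T ∪ G.incidenceFinset z).card ≤ T.card + 1 := by
  have h := Finset.card_union_add_card_inter T (G.incidenceFinset z)
  have hsub : {s(z, t), s(z, t')} ⊆ T ∩ G.incidenceFinset z := by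
    intro e he
    rcases Finset.mem_insert.1 he with rfl | he
    · exact Finset.mem_inter.2 ⟨ht (by simp [SimpleGraph.incidenceSet, hzt]),
        by simp [SimpleGraph.incidenceSet, hzt]⟩
    · rw [Finset.mem_singleton.1 he]
      exact Finset.mem_inter.2 ⟨ht' (by simp [SimpleGraph.incidenceSet, hzt']),
        by simp [SimpleGraph.incidenceSet, hzt']⟩
  have hcard := Finset.card_le_card hsub
  rw [Finset.card_pair fun he => htt' (Sym2.congr_right.1 he)] at hcard
  rw [SimpleGraph.card_incidenceFinset_eq_degree] at h
  have := hG z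
  omega

section Bounds

variable {u v a b c d : V}

theorem card_conflicts_le_twelve
    (hG : ∀ v, G.degree v ≤ 3) (hu : ∀ x, G.Adj u x → x = v ∨ x = a ∨ x = b)
    (hv : ∀ x, G.Adj v x → x = u ∨ x = c ∨ x = d) :
    (conflicts G s(u, v)).card ≤ 12 := by
  have h₀ := Finset.card_le_card (conflicts_subset hu hv)
  have h₁ := hG a
  have h₂ := card_union_incidenceFinset_le hG (G.incidenceFinset a) b
  have h₃ := card_union_incidenceFinset_le hG (G.incidenceFinset a ∪ G.incidenceFinset b) c
  have h₄ := card_union_incidenceFinset_le hG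
    (G.incidenceFinset a ∪ G.incidenceFinset b ∪ G.incidenceFinset c) d
  rw [SimpleGraph.card_incidenceFinset_eq_degree] at h₂
  omega

theorem card_conflicts_le_eleven_of_adj_left
    (hG : ∀ v, G.degree v ≤ 3) (hu : ∀ x, G.Adj u x → x = v ∨ x = a ∨ x = b)
    (hv : ∀ x, G.Adj v x → x = u ∨ x = c ∨ x = d)
    (hab : G.Adj a b) :
    (conflicts G s(u, v)).card ≤ 11 := by
  have h₀ := Finset.card_le_card (conflicts_subset hu hv)
  have h₁ := hG a
  have h₂ := card_union_incidenceFinset_le_of_mem hG hab.symm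
    (Finset.Subset.refl (G.incidenceFinset a))
  have h₃ := card_union_incidenceFinset_le hG (G.incidenceFinset a ∪ G.incidenceFinset b) c
  have h₄ := card_union_incidenceFinset_le hG
    (G.incidenceFinset a ∪ G.incidenceFinset b ∪ G.incidenceFinset c) d
  rw [SimpleGraph.card_incidenceFinset_eq_degree] at h₂
  omega

theorem card_conflicts_le_eleven
    (hG : ∀ v, G.degree v ≤ 3) (hu : ∀ x, G.Adj u x → x = v ∨ x = a ∨ x = b)
    (hv : ∀ x, G.Adj v x → x = u ∨ x = c ∨ x = d)
    (hac : G.Adj a c) : (conflicts G s(u, v)).card ≤ 11 := by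
  have h₀ := Finset.card_le_card (conflicts_subset hu hv)
  have h₁ := hG a
  have h₂ := card_union_incidenceFinset_le hG (G.incidenceFinset a) b
  have h₃ := card_union_incidenceFinset_le_of_mem hG hac.symm
    (Finset.subset_union_left (s₁ := G.incidenceFinset a) (s₂ := G.incidenceFinset b))
  have h₄ := card_union_incidenceFinset_le hG
    (G.incidenceFinset a ∪ G.incidenceFinset b ∪ G.incidenceFinset c) d
  rw [SimpleGraph.card_incidenceFinset_eq_degree] at h₂
  omega

theorem card_conflicts_le_ten
    (hG : ∀ v, G.degree v ≤ 3) (hu : ∀ x, G.Adj u x → x = v ∨ x = a ∨ x = b)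
    (hv : ∀ x, G.Adj v x → x = u ∨ x = c ∨ x = d)
    (hac : G.Adj a c) (hbd : G.Adj b d) :
    (conflicts G s(u, v)).card ≤ 10 := by
  have h₀ := Finset.card_le_card (conflicts_subset hu hv)
  have h₁ := hG a
  have h₂ := card_union_incidenceFinset_le hG (G.incidenceFinset a) b
  have h₃ := card_union_incidenceFinset_le_of_mem hG hac.symm
    (Finset.subset_union_left (s₁ := G.incidenceFinset a) (s₂ := G.incidenceFinset b))
  have h₄ := card_union_incidenceFinset_le_of_mem hG hbd.symm
    ((Finset.subset_union_right (s₁ := G.incidenceFinset a)).trans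
      (Finset.subset_union_left (s₂ := G.incidenceFinset c)))
  rw [SimpleGraph.card_incidenceFinset_eq_degree] at h₂
  omega

theorem card_conflicts_le_ten_of_adj_adj
    (hG : ∀ v, G.degree v ≤ 3) (hu : ∀ x, G.Adj u x → x = v ∨ x = a ∨ x = b)
    (hv : ∀ x, G.Adj v x → x = u ∨ x = c ∨ x = d)
    (hab : a ≠ b) (hac : G.Adj a c) (hbc : G.Adj b c) :
    (conflicts G s(u, v)).card ≤ 10 := by
  have h₀ := Finset.card_le_card (conflicts_subset hu hv)
  have h₁ := hG a
  have h₂ := card_union_incidenceFinset_le hG (G.incidenceFinset a) b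
  have h₃ := card_union_incidenceFinset_le_of_mem_of_mem hG hac.symm hbc.symm hab
    (Finset.subset_union_left (s₁ := G.incidenceFinset a) (s₂ := G.incidenceFinset b))
    Finset.subset_union_right
  have h₄ := card_union_incidenceFinset_le hG
    (G.incidenceFinset a ∪ G.incidenceFinset b ∪ G.incidenceFinset c) d
  rw [SimpleGraph.card_incidenceFinset_eq_degree] at h₂
  omega

theorem card_conflicts_le_nine
    (hG : ∀ v, G.degree v ≤ 3) (hu : ∀ x, G.Adj u x → x = v ∨ x = a ∨ x = b)
    (hv : ∀ x, G.Adj v x → x = u ∨ x = c ∨ x = d)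
    (hab : a ≠ b) (hac : G.Adj a c) (hbc : G.Adj b c)
    (had : G.Adj a d) : (conflicts G s(u, v)).card ≤ 9 := by
  have h₀ := Finset.card_le_card (conflicts_subset hu hv)
  have h₁ := hG a
  have h₂ := card_union_incidenceFinset_le hG (G.incidenceFinset a) b
  have h₃ := card_union_incidenceFinset_le_of_mem_of_mem hG hac.symm hbc.symm hab
    (Finset.subset_union_left (s₁ := G.incidenceFinset a) (s₂ := G.incidenceFinset b))
    Finset.subset_union_right
  have h₄ := card_union_incidenceFinset_le_of_mem hG had.symm
    ((Finset.subset_union_left (s₁ := G.incidenceFinset a) (s₂ := G.incidenceFinset b)).trans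
      (Finset.subset_union_left (s₂ := G.incidenceFinset c)))
  rw [SimpleGraph.card_incidenceFinset_eq_degree] at h₂
  omega

theorem card_conflicts_le_nine_of_eq
    (hG : ∀ v, G.degree v ≤ 3) (hu : ∀ x, G.Adj u x → x = v ∨ x = a ∨ x = b)
    (hv : ∀ x, G.Adj v x → x = u ∨ x = c ∨ x = d)
    (hcd : c = a ∨ c = d) :
    (conflicts G s(u, v)).card ≤ 9 := by
  have h₀ : (conflicts G s(u, v)).card ≤
      (G.incidenceFinset a ∪ G.incidenceFinset b ∪ G.incidenceFinset d).card := by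
    refine Finset.card_le_card ((conflicts_subset hu hv).trans ?_)
    rcases hcd with rfl | rfl <;> intro x hx <;> simp only [Finset.mem_union] at hx ⊢ <;> tauto
  have h₁ := hG a
  have h₂ := card_union_incidenceFinset_le hG (G.incidenceFinset a) b
  have h₃ := card_union_incidenceFinset_le hG (G.incidenceFinset a ∪ G.incidenceFinset b) d
  rw [SimpleGraph.card_incidenceFinset_eq_degree] at h₂
  omega

end Bounds

theorem exists_neighbors_of_degree_le (hG : ∀ v, G.degree v ≤ 3) {v w : V} (hvw : G.Adj v w) :
    ∃ a b, ∀ x, G.Adj v x → x = w ∨ x = a ∨ x = b := by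
  have hw : w ∈ G.neighborFinset v := by simpa using hvw
  have hcard : ((G.neighborFinset v).erase w).card ≤ 2 := by
    rw [Finset.card_erase_of_mem hw, SimpleGraph.card_neighborFinset_eq_degree]
    have := hG v
    omega
  obtain ⟨a, b, hab⟩ : ∃ a b, (G.neighborFinset v).erase w ⊆ {a, b} := by
    interval_cases hc : ((G.neighborFinset v).erase w).card
    · exact ⟨w, w, by simp [Finset.card_eq_zero.1 hc]⟩
    · obtain ⟨a, ha⟩ := Finset.card_eq_one.1 hc
      exact ⟨a, a, by simp [ha]⟩
    · obtain ⟨a, b, _, hab⟩ := Finset.card_eq_two.1 hc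
      exact ⟨a, b, hab.subset⟩
  refine ⟨a, b, fun x hx => ?_⟩
  by_cases hxw : x = w
  · exact Or.inl hxw
  · exact Or.inr (by simpa using hab (Finset.mem_erase.2 ⟨hxw, by simpa using hx⟩))

end Conflicts

/-- A subcubic graph that is not colorable from lists of at least 10 colors, all of whose proper
subgraphs are. -/
structure IsCritical {V : Type*} [Fintype V] (G : SimpleGraph V) [DecidableRel G.Adj]
    (L : Sym2 V → Finset ℕ) : Prop where
  degree_le : ∀ v, G.degree v ≤ 3
  le_card : ∀ e ∈ G.edgeSet, 10 ≤ (L e).card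
  not_colorable : ¬ ∃ φ, IsStrongListColoring G L φ
  minimal : ∀ H : SimpleGraph V, H ≤ G → H ≠ G → ∃ φ, IsStrongListColoring H L φ

namespace IsCritical

variable {V : Type*} [Fintype V] [DecidableEq V] {G : SimpleGraph V} [DecidableRel G.Adj]
  {L : Sym2 V → Finset ℕ}

/-- Uncoloring a family `E` of edges containing all the edges at some vertex `v` leaves a list
coloring problem without solution. If `E i` has at most `m i` conflicts, and among them the
members of `E` with index in `A i`, then its list has at least `10 + (A i).card - m i` colors. -/
theorem not_choosableOn {ι : Type*} [Fintype ι] [DecidableEq ι] (h : IsCritical G L)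
    {E : ι → Sym2 V} (hinj : Function.Injective E) (hE : ∀ i, E i ∈ G.edgeSet) {v w : V}
    (hvw : G.Adj v w) (hv : ∀ x, G.Adj v x → ∃ i, E i = s(v, x)) (A : ι → Finset ι)
    (hA : ∀ i, ∀ j ∈ A i, edgeConflict G (E i) (E j)) (m : ι → ℕ)
    (hm : ∀ i, (conflicts G (E i)).card ≤ m i) :
    ¬ ChoosableOn (fun i j => edgeConflict G (E i) (E j)) Finset.univ
      fun i => 10 + (A i).card - m i := by
  intro hch
  obtain ⟨φ, hφ, hφL⟩ := h.minimal (G.deleteIncidenceSet v) (G.deleteIncidenceSet_le v) (by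
    intro heq
    have := heq ▸ hvw
    simp [G.deleteIncidenceSet_adj] at this)
  have hH : ∀ e ∈ G.edgeSet, e ∉ Set.range E → v ∉ e ∧ e ∈ (G.deleteIncidenceSet v).edgeSet := by
    intro e he heE
    have hve : v ∉ e := by
      intro hve
      obtain ⟨x, rfl⟩ := hve
      exact heE (hv x he)
    refine ⟨hve, ?_⟩
    induction e with | _ x y
    rw [SimpleGraph.mem_edgeSet, G.deleteIncidenceSet_adj]
    simp only [Sym2.mem_iff, not_or] at hve
    exact ⟨he, Ne.symm hve.1, Ne.symm hve.2⟩
  set C : ι → Finset (Sym2 V) := fun i => conflicts G (E i) \ Finset.univ.image E with hC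
  obtain ⟨ψ, hψL, hψ⟩ := hch (fun i => L (E i) \ (C i).image φ) (by
    intro i _
    have h1 : (A i).card + (C i).card ≤ m i := by
      refine le_trans ?_ (hm i)
      rw [← Finset.card_image_of_injective (A i) hinj, ← Finset.card_union_of_disjoint]
      · refine Finset.card_le_card (Finset.union_subset (fun e he => ?_) Finset.sdiff_subset)
        obtain ⟨j, hj, rfl⟩ := Finset.mem_image.1 he
        exact mem_conflicts.2 ⟨hE j, hA i j hj⟩
      · refine Finset.disjoint_left.2 fun e he he' => (Finset.mem_sdiff.1 he').2 ?_
        exact Finset.image_subset_image (Finset.subset_univ _) he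
    have h2 := Finset.le_card_sdiff ((C i).image φ) (L (E i))
    have h3 : ((C i).image φ).card ≤ (C i).card := Finset.card_image_le
    have h4 := h.le_card (E i) (hE i)
    dsimp only
    omega)
  have hcross : ∀ i, ∀ f ∈ G.edgeSet, f ∉ Set.range E → edgeConflict G (E i) f → ψ i ≠ φ f := by
    intro i f hf hfE hc heq
    refine (Finset.mem_sdiff.1 (hψL i (Finset.mem_univ i))).2 ?_
    rw [heq]
    refine Finset.mem_image_of_mem _ (Finset.mem_sdiff.2 ⟨mem_conflicts.2 ⟨hf, hc⟩, ?_⟩)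
    simpa using hfE
  refine h.not_colorable ⟨Function.extend E ψ φ, fun e he f hf hc => ?_, fun e he => ?_⟩
  · by_cases heE : e ∈ Set.range E <;> by_cases hfE : f ∈ Set.range E
    · obtain ⟨i, rfl⟩ := heE
      obtain ⟨j, rfl⟩ := hfE
      rw [hinj.extend_apply, hinj.extend_apply]
      exact hψ i (Finset.mem_univ i) j (Finset.mem_univ j) (fun hij => hc.1 (congrArg E hij)) hc
    · obtain ⟨i, rfl⟩ := heE
      rw [hinj.extend_apply, Function.extend_apply' _ _ _ hfE]
      exact hcross i f hf hfE hc
    · obtain ⟨j, rfl⟩ := hfE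
      rw [hinj.extend_apply, Function.extend_apply' _ _ _ heE]
      exact (hcross j e he heE hc.symm).symm
    · rw [Function.extend_apply' _ _ _ heE, Function.extend_apply' _ _ _ hfE]
      obtain ⟨hve, heH⟩ := hH e he heE
      obtain ⟨hvf, hfH⟩ := hH f hf hfE
      exact hφ e heH f hfH (hc.deleteIncidenceSet hve hvf)
  · by_cases heE : e ∈ Set.range E
    · obtain ⟨i, rfl⟩ := heE
      rw [hinj.extend_apply]
      exact (Finset.mem_sdiff.1 (hψL i (Finset.mem_univ i))).1
    · rw [Function.extend_apply' _ _ _ heE]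
      exact hφL e (hH e he heE).2

theorem degree_eq (h : IsCritical G L) {v w : V} (hvw : G.Adj v w) : G.degree v = 3 := by
  by_contra hne
  have hdeg : G.degree v ≤ 2 := by
    have := h.degree_le v
    omega
  have hpos : 0 < G.degree v := (G.degree_pos_iff_exists_adj v).2 ⟨w, hvw⟩
  have hcard : Fintype.card {x // G.Adj v x} = G.degree v := by
    rw [← SimpleGraph.card_neighborFinset_eq_degree, Fintype.card_subtype]
    congr 1
    ext x
    simp
  refine h.not_choosableOn (E := fun x : {x // G.Adj v x} => s(v, x.1)) ?_ (fun x => x.2) hvw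
    (fun x hx => ⟨⟨x, hx⟩, rfl⟩) (fun i => Finset.univ.erase i) ?_ (fun _ => 9) ?_ ?_
  · intro x y hxy
    exact Subtype.ext (Sym2.congr_right.1 hxy)
  · intro i j hij
    refine edgeConflict_mk.2 ⟨?_, Or.inl rfl⟩
    exact fun he => (Finset.mem_erase.1 hij).1 (Subtype.ext (Sym2.congr_right.1 he)).symm
  · rintro ⟨x, hx⟩
    obtain ⟨c, d, hcd⟩ := exists_neighbors_of_degree_le h.degree_le hx.symm
    obtain ⟨a, ha⟩ : ∃ a, (G.neighborFinset v).erase x ⊆ {a} := by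
      have : ((G.neighborFinset v).erase x).card ≤ 1 := by
        rw [Finset.card_erase_of_mem (by simpa using hx),
          SimpleGraph.card_neighborFinset_eq_degree]
        omega
      have : Nonempty V := ⟨v⟩
      exact Finset.card_le_one_iff_subset_singleton.1 ‹_›
    have hv : ∀ y, G.Adj v y → y = x ∨ y = a ∨ y = a := by
      intro y hy
      by_cases hyx : y = x
      · exact Or.inl hyx
      · have := ha (Finset.mem_erase.2 ⟨hyx, by simpa using hy⟩)
        simp_all
    rw [Sym2.eq_swap]
    exact card_conflicts_le_nine_of_eq h.degree_le hcd hv (Or.inr rfl)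
  · refine choosableOn_of_card_le (fun _ _ hij => hij.symm) fun i _ => ?_
    rw [Finset.card_erase_of_mem (Finset.mem_univ _), Finset.card_univ, hcard]
    omega

theorem exists_third (h : IsCritical G L) {v a b : V} (ha : G.Adj v a) (hb : G.Adj v b)
    (hab : a ≠ b) : ∃ c, c ≠ a ∧ c ≠ b ∧ c ≠ v ∧ ∀ x, G.Adj v x ↔ x = a ∨ x = b ∨ x = c := by
  have hcard : (((G.neighborFinset v).erase a).erase b).card = 1 := by
    rw [Finset.card_erase_of_mem, Finset.card_erase_of_mem,
      SimpleGraph.card_neighborFinset_eq_degree, h.degree_eq ha]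
    · simpa using ha
    · simpa [hab.symm] using hb
  obtain ⟨c, hc⟩ := Finset.card_eq_one.1 hcard
  have hmem : ∀ x, x ≠ b ∧ x ≠ a ∧ G.Adj v x ↔ x = c := fun x => by
    simpa using Finset.ext_iff.1 hc x
  have hc' := (hmem c).2 rfl
  refine ⟨c, hc'.2.1, hc'.1, hc'.2.2.ne', fun x => ⟨fun hx => ?_, ?_⟩⟩
  · have := hmem x
    tauto
  · rintro (rfl | rfl | rfl)
    exacts [ha, hb, hc'.2.2]

theorem adj_iff (h : IsCritical G L) {v a b c : V} (ha : G.Adj v a) (hb : G.Adj v b)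
    (hc : G.Adj v c) (hab : a ≠ b) (hbc : b ≠ c) (hca : c ≠ a) (x : V) :
    G.Adj v x ↔ x = a ∨ x = b ∨ x = c := by
  obtain ⟨d, _, _, _, hv⟩ := h.exists_third ha hb hab
  grind

theorem card_conflicts_le (h : IsCritical G L) {u v : V} (huv : G.Adj u v) :
    (conflicts G s(u, v)).card ≤ 12 := by
  obtain ⟨a, b, hu⟩ := exists_neighbors_of_degree_le h.degree_le huv
  obtain ⟨c, d, hv⟩ := exists_neighbors_of_degree_le h.degree_le huv.symm
  exact card_conflicts_le_twelve h.degree_le hu hv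

/-- An edge of a 4-cycle has at most 11 conflicts. -/
theorem card_conflicts_le_of_four_cycle (h : IsCritical G L) {u v a c : V} (huv : G.Adj u v)
    (hua : G.Adj u a) (hac : G.Adj a c) (hcv : G.Adj c v) (hav : a ≠ v) (hcu : c ≠ u) :
    (conflicts G s(u, v)).card ≤ 11 := by
  obtain ⟨b, _, _, _, hu⟩ := h.exists_third huv hua hav.symm
  obtain ⟨d, _, _, _, hv⟩ := h.exists_third huv.symm hcv.symm hcu.symm
  exact card_conflicts_le_eleven h.degree_le (fun x => (hu x).1) (fun x => (hv x).1) hac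

/-- A version of `not_choosableOn` for edges given by their endpoints `p i` and `q i`. -/
theorem not_choosableOn_fin {n : ℕ} (h : IsCritical G L) (p q : Fin n → V)
    (hE : ∀ i, G.Adj (p i) (q i)) (hinj : ∀ i j, i < j → s(p i, q i) ≠ s(p j, q j))
    {v a b c : V} (hv : ∀ x, G.Adj v x ↔ x = a ∨ x = b ∨ x = c)
    (ha : ∃ i, s(p i, q i) = s(v, a)) (hb : ∃ i, s(p i, q i) = s(v, b))
    (hc : ∃ i, s(p i, q i) = s(v, c)) (A : Fin n → Finset (Fin n)) (hA₀ : ∀ i, i ∉ A i)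
    (hA : ∀ i, ∀ j ∈ A i, p i = p j ∨ p i = q j ∨ q i = p j ∨ q i = q j ∨
      G.Adj (p i) (p j) ∨ G.Adj (p i) (q j) ∨ G.Adj (q i) (p j) ∨ G.Adj (q i) (q j))
    (m : Fin n → ℕ) (hm : ∀ i, (conflicts G s(p i, q i)).card ≤ m i) {f : Fin n → ℕ}
    (hf : ∀ i, f i ≤ 10 + (A i).card - m i) :
    ¬ ChoosableOn (fun i j => edgeConflict G s(p i, q i) s(p j, q j)) Finset.univ f := by
  intro hch
  have hinj' : Function.Injective fun i => s(p i, q i) := by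
    intro i j hij
    rcases lt_trichotomy i j with hlt | heq | hlt
    · exact absurd hij (hinj i j hlt)
    · exact heq
    · exact absurd hij.symm (hinj j i hlt)
  refine h.not_choosableOn hinj' hE ((hv a).2 (Or.inl rfl)) ?_ A (fun i j hij => ?_) m hm
    (hch.mono (Finset.Subset.refl _) fun i _ => hf i)
  · intro x hx
    rcases (hv x).1 hx with rfl | rfl | rfl
    exacts [ha, hb, hc]
  · exact edgeConflict_mk.2 ⟨fun he => hA₀ i (by rwa [hinj' he] at hij ⊢), hA i j hij⟩

/-- A critical graph has no triangle. -/
theorem no_triangle (h : IsCritical G L) {u v w : V} (huv : G.Adj u v) (hvw : G.Adj v w)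
    (hwu : G.Adj w u) : False := by
  obtain ⟨u', _, _, hu₀, hu⟩ := h.exists_third huv hwu.symm hvw.ne
  obtain ⟨v', _, _, _, hv⟩ := h.exists_third huv.symm hvw hwu.ne.symm
  obtain ⟨w', _, _, _, hw⟩ := h.exists_third hwu hvw.symm huv.ne
  have huu' : G.Adj u u' := by simp [hu]
  obtain ⟨c, d, hu'⟩ := exists_neighbors_of_degree_le h.degree_le huu'.symm
  have := huv.ne
  have := hvw.ne
  have := hwu.ne
  refine h.not_choosableOn_fin ![u, u, u] ![v, w, u'] ?_ ?_ hu ⟨0, rfl⟩ ⟨1, rfl⟩ ⟨2, rfl⟩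
    ![{1, 2}, {0, 2}, {0, 1}] (by decide) ?_ ![9, 9, 11] ?_ (f := ![3, 3, 1]) (by decide) ?_
  · simp [Fin.forall_fin_succ, *]
  · simp [Fin.forall_fin_succ, *]
    grind
  · simp [Fin.forall_fin_succ, *]
  · rw [Fin.forall_fin_succ, Fin.forall_fin_succ, Fin.forall_fin_succ]
    refine ⟨?_, ?_, ?_, fun i => i.elim0⟩
    · exact card_conflicts_le_nine_of_eq h.degree_le (a := w) (c := w) (fun x => (hu x).1)
        (fun x hx => (hv x).1 hx) (Or.inl rfl)
    · exact card_conflicts_le_nine_of_eq h.degree_le (a := v) (b := u') (c := v) (d := w')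
        (fun x hx => by have := (hu x).1 hx; tauto)
        (fun x hx => by have := (hw x).1 hx; tauto) (Or.inl rfl)
    · exact card_conflicts_le_eleven_of_adj_left h.degree_le (a := v) (b := w)
        (fun x hx => by have := (hu x).1 hx; tauto) hu' hvw
  · exact choosableOn_of_toFinset (fun _ _ => edgeConflict.symm) [0, 1, 2] (by decide) (by decide)

/-- An edge of a complete bipartite subgraph `K₂₃` has at most 10 conflicts. -/
theorem card_conflicts_le_of_common_neighbors (h : IsCritical G L) {x y a b c : V} (hxy : x ≠ y)
    (hab : a ≠ b) (hbc : b ≠ c) (hca : c ≠ a) (hxa : G.Adj x a) (hxb : G.Adj x b)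
    (hxc : G.Adj x c) (hya : G.Adj y a) (hyb : G.Adj y b) (hyc : G.Adj y c) :
    (conflicts G s(x, c)).card ≤ 10 := by
  obtain ⟨d, _, _, _, hx⟩ := h.exists_third hxa hxb hab
  obtain ⟨c', _, _, _, hc⟩ := h.exists_third hxc.symm hyc.symm hxy
  exact card_conflicts_le_ten_of_adj_adj h.degree_le (a := a) (b := b) (c := y) (d := c')
    (by grind) (by grind) hab hya.symm hyb.symm

/-- If two vertices have the same neighbors `a`, `b` and `c`, then `a` and `b` have no third
common neighbor. -/
theorem ne_of_common_neighbors (h : IsCritical G L) {x y a b c a' b' : V} (hxy : x ≠ y)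
    (hab : a ≠ b) (hbc : b ≠ c) (hca : c ≠ a)
    (hx : ∀ z, G.Adj x z ↔ z = a ∨ z = b ∨ z = c) (hy : ∀ z, G.Adj y z ↔ z = a ∨ z = b ∨ z = c)
    (ha : ∀ z, G.Adj a z ↔ z = x ∨ z = y ∨ z = a')
    (hb : ∀ z, G.Adj b z ↔ z = x ∨ z = y ∨ z = b') : a' ≠ b' := by
  rintro rfl
  have hxa : (conflicts G s(x, a)).card ≤ 9 :=
    card_conflicts_le_nine h.degree_le (a := b) (b := c) (c := y) (d := a')
      (by grind) (by grind) hbc (by simp [*]) ((hy c).2 (by simp)).symm (by simp [*])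
  have hxb : (conflicts G s(x, b)).card ≤ 9 :=
    card_conflicts_le_nine h.degree_le (a := a) (b := c) (c := y) (d := a')
      (by grind) (by grind) hca.symm (by simp [*]) ((hy c).2 (by simp)).symm (by simp [*])
  have hxc : (conflicts G s(x, c)).card ≤ 10 :=
    h.card_conflicts_le_of_common_neighbors hxy hab hbc hca (by simp [*]) (by simp [*])
      (by simp [*]) (by simp [*]) (by simp [*]) (by simp [*])
  refine h.not_choosableOn_fin ![x, x, x] ![a, b, c] ?_ ?_ hx ⟨0, rfl⟩ ⟨1, rfl⟩ ⟨2, rfl⟩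
    ![{1, 2}, {0, 2}, {0, 1}] (by decide) ?_ ![9, 9, 10] ?_ (f := ![3, 3, 2]) (by decide) ?_
  · simp [Fin.forall_fin_succ, *]
  · simp [Fin.forall_fin_succ, *]
    grind
  · simp [Fin.forall_fin_succ, *]
  · simp [Fin.forall_fin_succ, *]
  · exact choosableOn_of_toFinset (fun _ _ => edgeConflict.symm) [0, 1, 2] (by decide) (by decide)



/-- The case of `no_common_neighbors` where the third neighbors of `a` and `c` are not adjacent. -/
theorem no_common_neighbors_of_not_adj (h : IsCritical G L) {x y a b c a' b' c' : V} (hxy : x ≠ y)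
    (hab : a ≠ b) (hbc : b ≠ c) (hca : c ≠ a)
    (hx : ∀ z, G.Adj x z ↔ z = a ∨ z = b ∨ z = c) (hy : ∀ z, G.Adj y z ↔ z = a ∨ z = b ∨ z = c)
    (ha : ∀ z, G.Adj a z ↔ z = x ∨ z = y ∨ z = a') (hb : ∀ z, G.Adj b z ↔ z = x ∨ z = y ∨ z = b')
    (hc : ∀ z, G.Adj c z ↔ z = x ∨ z = y ∨ z = c') (hac' : ¬ G.Adj a' c')
    (hbc' : G.Adj b' c' → G.Adj a' b') (hax' : a' ≠ x) (hay' : a' ≠ y) (hbx' : b' ≠ x)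
    (hby' : b' ≠ y) (hcx' : c' ≠ x) (hcy' : c' ≠ y) : False := by
  have hxa : G.Adj x a := by simp [hx]
  have hxb : G.Adj x b := by simp [hx]
  have hxc : G.Adj x c := by simp [hx]
  have hya : G.Adj y a := by simp [hy]
  have hyb : G.Adj y b := by simp [hy]
  have hyc : G.Adj y c := by simp [hy]
  have haa' : G.Adj a a' := by simp [ha]
  have hbb' : G.Adj b b' := by simp [hb]
  have hcc' : G.Adj c c' := by simp [hc]
  have nab : ¬ G.Adj a b := fun hab => h.no_triangle hxa hab hxb.symm
  have nbc : ¬ G.Adj b c := fun hbc => h.no_triangle hxb hbc hxc.symm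
  have nca : ¬ G.Adj c a := fun hca => h.no_triangle hxc hca hxa.symm
  have hab' : a' ≠ b' := h.ne_of_common_neighbors hxy hab hbc hca hx hy ha hb
  have hbc' : b' ≠ c' := h.ne_of_common_neighbors hxy hbc hca hab (by grind) (by grind) hb hc
  have hca' : c' ≠ a' := h.ne_of_common_neighbors hxy hca hab hbc (by grind) (by grind) hc ha
  have := h.card_conflicts_le_of_common_neighbors hxy hab hbc hca hxa hxb hxc hya hyb hyc
  have := h.card_conflicts_le_of_common_neighbors hxy hbc hca hab hxb hxc hxa hyb hyc hya
  have := h.card_conflicts_le_of_common_neighbors hxy hca hab hbc hxc hxa hxb hyc hya hyb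
  have := h.card_conflicts_le_of_common_neighbors hxy.symm hab hbc hca hya hyb hyc hxa hxb hxc
  have := h.card_conflicts_le_of_common_neighbors hxy.symm hbc hca hab hyb hyc hya hxb hxc hxa
  have := h.card_conflicts_le_of_common_neighbors hxy.symm hca hab hbc hyc hya hyb hxc hxa hxb
  have := h.card_conflicts_le haa'
  have := h.card_conflicts_le hbb'
  have := h.card_conflicts_le hcc'
  have hinj : ∀ i j : Fin 9, i < j → s(![x, x, x, y, y, y, a, b, c] i,
      ![a, b, c, a, b, c, a', b', c'] i) ≠ s(![x, x, x, y, y, y, a, b, c] j,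
      ![a, b, c, a, b, c, a', b', c'] j) := by
    simp [Fin.forall_fin_succ, *]
    grind
  have h68 : ¬ edgeConflict G s(a, a') s(c, c') := by
    rw [edgeConflict_mk]
    grind [G.adj_comm]
  by_cases hadj : G.Adj a' b'
  · have := hadj.symm
    refine h.not_choosableOn_fin ![x, x, x, y, y, y, a, b, c] ![a, b, c, a, b, c, a', b', c'] ?_
      hinj hx ⟨0, rfl⟩ ⟨1, rfl⟩ ⟨2, rfl⟩ ![{0}ᶜ, {1}ᶜ, {2}ᶜ, {3}ᶜ, {4}ᶜ, {5}ᶜ, {6, 8}ᶜ, {7, 8}ᶜ,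
        {6, 7, 8}ᶜ] (by decide) ?_ ![10, 10, 10, 10, 10, 10, 12, 12, 12] ?_ (by decide)
      (choosableOn_two_three' (fun _ _ => edgeConflict.symm) h68)
    · simp [Fin.forall_fin_succ, *]
    · simp [Fin.forall_fin_succ, *]
    · simp [Fin.forall_fin_succ, *]
  · refine h.not_choosableOn_fin ![x, x, x, y, y, y, a, b, c] ![a, b, c, a, b, c, a', b', c'] ?_
      hinj hx ⟨0, rfl⟩ ⟨1, rfl⟩ ⟨2, rfl⟩ ![{0}ᶜ, {1}ᶜ, {2}ᶜ, {3}ᶜ, {4}ᶜ, {5}ᶜ, {6, 7, 8}ᶜ,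
        {6, 7, 8}ᶜ, {6, 7, 8}ᶜ] (by decide) ?_ ![10, 10, 10, 10, 10, 10, 12, 12, 12] ?_ (by decide)
      (choosableOn_two_three (fun _ _ => edgeConflict.symm) ?_ h68 ?_)
    · simp [Fin.forall_fin_succ, *]
    · simp [Fin.forall_fin_succ, *]
    · simp [Fin.forall_fin_succ, *]
    · change ¬ edgeConflict G s(a, a') s(b, b')
      rw [edgeConflict_mk]
      grind [G.adj_comm]
    · change ¬ edgeConflict G s(b, b') s(c, c')
      rw [edgeConflict_mk]
      grind [G.adj_comm]

/-- A critical graph contains no complete bipartite graph `K₂₃`. -/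
theorem no_common_neighbors (h : IsCritical G L) {x y a b c : V} (hxy : x ≠ y)
    (hab : a ≠ b) (hbc : b ≠ c) (hca : c ≠ a) (hxa : G.Adj x a) (hxb : G.Adj x b)
    (hxc : G.Adj x c) (hya : G.Adj y a) (hyb : G.Adj y b) (hyc : G.Adj y c) : False := by
  obtain ⟨a', hax', hay', _, ha⟩ := h.exists_third hxa.symm hya.symm hxy
  obtain ⟨b', hbx', hby', _, hb⟩ := h.exists_third hxb.symm hyb.symm hxy
  obtain ⟨c', hcx', hcy', _, hc⟩ := h.exists_third hxc.symm hyc.symm hxy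
  have hx : ∀ z, G.Adj x z ↔ z = a ∨ z = b ∨ z = c := h.adj_iff hxa hxb hxc hab hbc hca
  have hy : ∀ z, G.Adj y z ↔ z = a ∨ z = b ∨ z = c := h.adj_iff hya hyb hyc hab hbc hca
  by_cases hac' : G.Adj a' c'
  · by_cases hab' : G.Adj a' b'
    · exact h.no_common_neighbors_of_not_adj hxy hab.symm hca.symm hbc.symm (by grind) (by grind)
        hb ha hc (fun hbc' => h.no_triangle hab' hbc' hac'.symm) (fun _ => hab'.symm)
        hbx' hby' hax' hay' hcx' hcy'
    · exact h.no_common_neighbors_of_not_adj hxy hca.symm hbc.symm hab.symm (by grind) (by grind)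
        ha hc hb hab' (fun _ => hac') hax' hay' hcx' hcy' hbx' hby'
  · by_cases hbc' : G.Adj b' c'
    · exact h.no_common_neighbors_of_not_adj hxy hbc.symm hab.symm hca.symm (by grind) (by grind)
        hc hb ha (fun hca' => hac' hca'.symm) (fun _ => hbc'.symm) hcx' hcy' hbx' hby' hax' hay'
    · exact h.no_common_neighbors_of_not_adj hxy hab hbc hca hx hy ha hb hc hac'
        (fun h => absurd h hbc') hax' hay' hbx' hby' hcx' hcy'

/-- In a critical graph no two 4-cycles share exactly one edge. -/
theorem no_ladder (h : IsCritical G L) {v₁ v₂ v₃ v₄ u₁ u₂ : V} (h₁₂ : G.Adj v₁ v₂)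
    (h₂₃ : G.Adj v₂ v₃) (h₃₄ : G.Adj v₃ v₄) (h₄₁ : G.Adj v₄ v₁) (h₁₃ : v₁ ≠ v₃) (h₂₄ : v₂ ≠ v₄)
    (k₁ : G.Adj v₁ u₁) (k₂ : G.Adj v₂ u₂) (k₁₂ : G.Adj u₁ u₂) (d₁₂ : u₁ ≠ v₂) (d₁₄ : u₁ ≠ v₄)
    (d₂₁ : u₂ ≠ v₁) (d₂₃ : u₂ ≠ v₃) : False := by
  have hv₁ := h.adj_iff h₁₂ h₄₁.symm k₁ h₂₄ d₁₄.symm d₁₂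
  have hv₂ := h.adj_iff h₁₂.symm h₂₃ k₂ h₁₃ d₂₃.symm d₂₁
  have n₁₃ : ¬ G.Adj v₁ v₃ := fun h₁₃ => h.no_triangle h₁₂ h₂₃ h₁₃.symm
  have n₂₄ : ¬ G.Adj v₂ v₄ := fun h₂₄ => h.no_triangle h₂₃ h₃₄ h₂₄.symm
  have m₁₄ : ¬ G.Adj u₁ v₄ := fun hu => h.no_triangle k₁ hu h₄₁
  have m₂₃ : ¬ G.Adj u₂ v₃ := fun hu => h.no_triangle k₂ hu h₂₃.symm
  have m₁₃ : ¬ G.Adj u₁ v₃ := fun hu =>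
    h.no_common_neighbors h₁₃ h₂₄ d₁₄.symm d₁₂ h₁₂ h₄₁.symm k₁ h₂₃.symm h₃₄ hu.symm
  have m₂₄ : ¬ G.Adj u₂ v₄ := fun hu =>
    h.no_common_neighbors h₂₄ h₁₃ d₂₃.symm d₂₁ h₁₂.symm h₂₃ k₂ h₄₁ h₃₄.symm hu.symm
  have := k₁₂.ne
  have := h₂₃.symm
  have := k₁.symm
  have := k₂.symm
  have : (conflicts G s(v₁, v₂)).card ≤ 10 :=
    card_conflicts_le_ten h.degree_le (a := v₄) (b := u₁) (c := v₃) (d := u₂)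
      (by grind) (by grind) h₃₄.symm k₁₂
  have := h.card_conflicts_le_of_four_cycle h₂₃ h₁₂.symm h₄₁.symm h₃₄.symm h₁₃ h₂₄.symm
  have := h.card_conflicts_le_of_four_cycle h₃₄ h₂₃.symm h₁₂.symm h₄₁.symm h₂₄ h₁₃
  have := h.card_conflicts_le_of_four_cycle h₄₁.symm h₁₂ h₂₃ h₃₄ h₂₄ h₁₃.symm
  have := h.card_conflicts_le_of_four_cycle k₁ h₁₂ k₂ k₁₂.symm d₁₂.symm d₂₁
  have := h.card_conflicts_le_of_four_cycle k₂ h₁₂.symm k₁ k₁₂ d₂₁.symm d₁₂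
  have := h.card_conflicts_le_of_four_cycle k₁₂ k₁.symm h₁₂ k₂ d₂₁.symm d₁₂.symm
  refine h.not_choosableOn_fin ![v₁, v₂, v₃, v₁, v₁, v₂, u₁] ![v₂, v₃, v₄, v₄, u₁, u₂, u₂] ?_ ?_
    hv₁ ⟨0, rfl⟩ ⟨3, rfl⟩ ⟨4, rfl⟩ ![{0}ᶜ, {1}ᶜ, {2, 6}ᶜ, {3}ᶜ, {4}ᶜ, {5}ᶜ, {2, 6}ᶜ] (by decide) ?_
    ![10, 11, 11, 11, 11, 11, 11] ?_ (by decide)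
    (choosableOn_ladder (fun _ _ => edgeConflict.symm) ?_)
  · simp [Fin.forall_fin_succ, *]
  · simp [Fin.forall_fin_succ, *]
    grind
  · simp [Fin.forall_fin_succ, *]
  · simp [Fin.forall_fin_succ, *]
  · change ¬ edgeConflict G s(v₃, v₄) s(u₁, u₂)
    rw [edgeConflict_mk]
    grind [G.adj_comm]

/-- In a critical graph, opposite vertices of a 4-cycle are not joined by a path of length 3
outside the cycle. -/
theorem no_theta (h : IsCritical G L) {v₁ v₂ v₃ v₄ u₁ u₃ : V} (h₁₂ : G.Adj v₁ v₂)
    (h₂₃ : G.Adj v₂ v₃) (h₃₄ : G.Adj v₃ v₄) (h₄₁ : G.Adj v₄ v₁) (h₁₃ : v₁ ≠ v₃) (h₂₄ : v₂ ≠ v₄)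
    (k₁ : G.Adj v₁ u₁) (k₃ : G.Adj v₃ u₃) (k₁₃ : G.Adj u₁ u₃) (d₁₂ : u₁ ≠ v₂) (d₁₄ : u₁ ≠ v₄)
    (d₃₂ : u₃ ≠ v₂) (d₃₄ : u₃ ≠ v₄) : False := by
  have hv₁ := h.adj_iff h₁₂ h₄₁.symm k₁ h₂₄ d₁₄.symm d₁₂
  have hv₃ := h.adj_iff h₂₃.symm h₃₄ k₃ h₂₄ d₃₄.symm d₃₂
  obtain ⟨u₂, d₂₁, d₂₃, _, hv₂⟩ := h.exists_third h₁₂.symm h₂₃ h₁₃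
  obtain ⟨u₄, d₄₁, d₄₃, _, hv₄⟩ := h.exists_third h₄₁ h₃₄.symm h₁₃
  have k₂ : G.Adj v₂ u₂ := by simp [hv₂]
  have k₄ : G.Adj v₄ u₄ := by simp [hv₄]
  have n₁₃ : ¬ G.Adj v₁ v₃ := fun h₁₃ => h.no_triangle h₁₂ h₂₃ h₁₃.symm
  have n₂₄ : ¬ G.Adj v₂ v₄ := fun h₂₄ => h.no_triangle h₂₃ h₃₄ h₂₄.symm
  have e₁₃ : v₁ ≠ u₃ := by grind [G.adj_comm]
  have e₃₁ : v₃ ≠ u₁ := by grind [G.adj_comm]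
  obtain ⟨w₁, _, _, _, hu₁⟩ := h.exists_third k₁.symm k₁₃ e₁₃
  obtain ⟨w₃, _, _, _, hu₃⟩ := h.exists_third k₃.symm k₁₃.symm e₃₁
  have l₁ : G.Adj u₁ w₁ := by simp [hu₁]
  have l₃ : G.Adj u₃ w₃ := by simp [hu₃]
  have hw : w₁ ≠ w₃ := fun hw => h.no_triangle k₁₃ l₃ (hw ▸ l₁.symm)
  have m₁₂ : ¬ G.Adj u₁ v₂ := fun hu => h.no_triangle k₁ hu h₁₂.symm
  have m₁₄ : ¬ G.Adj u₁ v₄ := fun hu => h.no_triangle k₁ hu h₄₁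
  have m₃₂ : ¬ G.Adj u₃ v₂ := fun hu => h.no_triangle k₃ hu h₂₃
  have m₃₄ : ¬ G.Adj u₃ v₄ := fun hu => h.no_triangle k₃ hu h₃₄.symm
  have n₁₂ : ¬ G.Adj u₁ u₂ := fun hu =>
    h.no_ladder h₁₂ h₂₃ h₃₄ h₄₁ h₁₃ h₂₄ k₁ k₂ hu d₁₂ d₁₄ d₂₁ d₂₃
  have n₂₃ : ¬ G.Adj u₂ u₃ := fun hu =>
    h.no_ladder h₂₃ h₃₄ h₄₁ h₁₂ h₂₄ h₁₃.symm k₂ k₃ hu d₂₃ d₂₁ d₃₂ d₃₄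
  have n₃₄ : ¬ G.Adj u₃ u₄ := fun hu =>
    h.no_ladder h₃₄ h₄₁ h₁₂ h₂₃ h₁₃.symm h₂₄.symm k₃ k₄ hu d₃₄ d₃₂ d₄₃ d₄₁
  have n₄₁ : ¬ G.Adj u₄ u₁ := fun hu =>
    h.no_ladder h₄₁ h₁₂ h₂₃ h₃₄ h₂₄.symm h₁₃ k₄ k₁ hu d₄₁ d₄₃ d₁₄ d₁₂
  have d₂₄ : u₂ ≠ u₄ := by
    rintro rfl
    exact h.no_common_neighbors h₂₄ h₁₃ d₂₃.symm d₂₁ h₁₂.symm h₂₃ k₂ h₄₁ h₃₄.symm k₄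
  have := h₁₂.ne
  have := h₂₃.ne
  have := h₃₄.ne
  have := h₄₁.ne
  have := k₁.ne
  have := k₃.ne
  have := k₁₃.ne
  have := h₁₂.symm
  have := h₂₃.symm
  have := h₃₄.symm
  have := h₄₁.symm
  have := k₁.symm
  have := k₃.symm
  have := k₁₃.symm
  have := h.card_conflicts_le_of_four_cycle h₁₂ h₄₁.symm h₃₄.symm h₂₃.symm h₂₄.symm h₁₃.symm
  have := h.card_conflicts_le_of_four_cycle h₂₃ h₁₂.symm h₄₁.symm h₃₄.symm h₁₃ h₂₄.symm
  have := h.card_conflicts_le_of_four_cycle h₃₄ h₂₃.symm h₁₂.symm h₄₁.symm h₂₄ h₁₃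
  have := h.card_conflicts_le_of_four_cycle h₄₁.symm h₁₂ h₂₃ h₃₄ h₂₄ h₁₃.symm
  have := h.card_conflicts_le k₁
  have := h.card_conflicts_le k₂
  have := h.card_conflicts_le k₃
  have := h.card_conflicts_le k₄
  have := h.card_conflicts_le k₁₃
  have := h.card_conflicts_le l₁
  have := h.card_conflicts_le l₃
  have hinj : ∀ i j : Fin 11, i < j → s(![v₁, v₂, v₃, v₁, v₁, v₃, u₁, u₁, u₃, v₂, v₄] i,
      ![v₂, v₃, v₄, v₄, u₁, u₃, u₃, w₁, w₃, u₂, u₄] i) ≠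
      s(![v₁, v₂, v₃, v₁, v₁, v₃, u₁, u₁, u₃, v₂, v₄] j,
      ![v₂, v₃, v₄, v₄, u₁, u₃, u₃, w₁, w₃, u₂, u₄] j) := by
    simp [Fin.forall_fin_succ, *]
    grind
  have h08 : ¬ edgeConflict G s(v₁, v₂) s(u₃, w₃) := by
    rw [edgeConflict_mk]
    grind [G.adj_comm]
  have h17 : ¬ edgeConflict G s(v₂, v₃) s(u₁, w₁) := by
    rw [edgeConflict_mk]
    grind [G.adj_comm]
  have h69 : ¬ edgeConflict G s(u₁, u₃) s(v₂, u₂) := by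
    rw [edgeConflict_mk]
    grind [G.adj_comm]
  by_cases k₂₄ : G.Adj u₂ u₄
  · have := k₂₄.symm
    refine h.not_choosableOn_fin ![v₁, v₂, v₃, v₁, v₁, v₃, u₁, u₁, u₃, v₂, v₄]
      ![v₂, v₃, v₄, v₄, u₁, u₃, u₃, w₁, w₃, u₂, u₄] ?_ hinj hv₁ ⟨0, rfl⟩ ⟨3, rfl⟩ ⟨4, rfl⟩
      ![{0, 8}ᶜ, {1, 7}ᶜ, {2, 7}ᶜ, {3, 8}ᶜ, {4}ᶜ, {5}ᶜ, {6, 9, 10}ᶜ, {0, 3, 4, 5, 6, 8},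
        {1, 2, 4, 5, 6, 7}, {0, 1, 2, 3, 4, 5, 10}, {0, 1, 2, 3, 4, 5, 9}] (by decide) ?_
      ![11, 11, 11, 11, 12, 12, 12, 12, 12, 12, 12] ?_ (by decide)
      (choosableOn_theta' (fun _ _ => edgeConflict.symm) h08 h17 h69)
    · simp [Fin.forall_fin_succ, *]
    · simp [Fin.forall_fin_succ, *]
    · simp [Fin.forall_fin_succ, *]
  · refine h.not_choosableOn_fin ![v₁, v₂, v₃, v₁, v₁, v₃, u₁, u₁, u₃, v₂, v₄]
      ![v₂, v₃, v₄, v₄, u₁, u₃, u₃, w₁, w₃, u₂, u₄] ?_ hinj hv₁ ⟨0, rfl⟩ ⟨3, rfl⟩ ⟨4, rfl⟩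
      ![{0, 8}ᶜ, {1, 7}ᶜ, {2, 7}ᶜ, {3, 8}ᶜ, {4}ᶜ, {5}ᶜ, {6, 9, 10}ᶜ, {0, 3, 4, 5, 6, 8},
        {1, 2, 4, 5, 6, 7}, {0, 1, 2, 3, 4, 5}, {0, 1, 2, 3, 4, 5}] (by decide) ?_
      ![11, 11, 11, 11, 12, 12, 12, 12, 12, 12, 12] ?_ (by decide)
      (choosableOn_theta (fun _ _ => edgeConflict.symm) h08 h17 h69 ?_ ?_)
    · simp [Fin.forall_fin_succ, *]
    · simp [Fin.forall_fin_succ, *]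
    · simp [Fin.forall_fin_succ, *]
    · change ¬ edgeConflict G s(u₁, u₃) s(v₄, u₄)
      rw [edgeConflict_mk]
      grind [G.adj_comm]
    · change ¬ edgeConflict G s(v₂, u₂) s(v₄, u₄)
      rw [edgeConflict_mk]
      grind [G.adj_comm]

/-- A critical graph has no 4-cycle. -/
theorem no_four_cycle (h : IsCritical G L) {v₁ v₂ v₃ v₄ : V} (h₁₂ : G.Adj v₁ v₂)
    (h₂₃ : G.Adj v₂ v₃) (h₃₄ : G.Adj v₃ v₄) (h₄₁ : G.Adj v₄ v₁) (h₁₃ : v₁ ≠ v₃) (h₂₄ : v₂ ≠ v₄) :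
    False := by
  obtain ⟨u₁, d₁₂, d₁₄, _, hv₁⟩ := h.exists_third h₁₂ h₄₁.symm h₂₄
  obtain ⟨u₂, d₂₁, d₂₃, _, hv₂⟩ := h.exists_third h₁₂.symm h₂₃ h₁₃
  obtain ⟨u₃, d₃₂, d₃₄, _, hv₃⟩ := h.exists_third h₂₃.symm h₃₄ h₂₄
  obtain ⟨u₄, d₄₁, d₄₃, _, hv₄⟩ := h.exists_third h₄₁ h₃₄.symm h₁₃
  have k₁ : G.Adj v₁ u₁ := by simp [hv₁]
  have k₂ : G.Adj v₂ u₂ := by simp [hv₂]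
  have k₃ : G.Adj v₃ u₃ := by simp [hv₃]
  have k₄ : G.Adj v₄ u₄ := by simp [hv₄]
  have n₁₃ : ¬ G.Adj v₁ v₃ := fun h₁₃ => h.no_triangle h₁₂ h₂₃ h₁₃.symm
  have n₂₄ : ¬ G.Adj v₂ v₄ := fun h₂₄ => h.no_triangle h₂₃ h₃₄ h₂₄.symm
  have m₁₃ : ¬ G.Adj u₁ u₃ := fun hu =>
    h.no_theta h₁₂ h₂₃ h₃₄ h₄₁ h₁₃ h₂₄ k₁ k₃ hu d₁₂ d₁₄ d₃₂ d₃₄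
  have m₂₄ : ¬ G.Adj u₂ u₄ := fun hu =>
    h.no_theta h₂₃ h₃₄ h₄₁ h₁₂ h₂₄ h₁₃.symm k₂ k₄ hu d₂₃ d₂₁ d₄₃ d₄₁
  have d₁₃ : u₁ ≠ u₃ := by
    rintro rfl
    exact h.no_common_neighbors h₁₃ h₂₄ d₁₄.symm d₁₂ h₁₂ h₄₁.symm k₁ h₂₃.symm h₃₄ k₃
  have d₂₄ : u₂ ≠ u₄ := by
    rintro rfl
    exact h.no_common_neighbors h₂₄ h₁₃ d₂₃.symm d₂₁ h₁₂.symm h₂₃ k₂ h₄₁ h₃₄.symm k₄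
  have := h₁₂.ne
  have := h₂₃.ne
  have := h₃₄.ne
  have := h₄₁.ne
  have := h₁₂.symm
  have := h₂₃.symm
  have := h₃₄.symm
  have := h₄₁.symm
  have := h.card_conflicts_le_of_four_cycle h₁₂ h₄₁.symm h₃₄.symm h₂₃.symm h₂₄.symm h₁₃.symm
  have := h.card_conflicts_le_of_four_cycle h₂₃ h₁₂.symm h₄₁.symm h₃₄.symm h₁₃ h₂₄.symm
  have := h.card_conflicts_le_of_four_cycle h₃₄ h₂₃.symm h₁₂.symm h₄₁.symm h₂₄ h₁₃
  have := h.card_conflicts_le_of_four_cycle h₄₁.symm h₁₂ h₂₃ h₃₄ h₂₄ h₁₃.symm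
  have := h.card_conflicts_le k₁
  have := h.card_conflicts_le k₂
  have := h.card_conflicts_le k₃
  have := h.card_conflicts_le k₄
  refine h.not_choosableOn_fin ![v₁, v₂, v₃, v₁, v₁, v₂, v₃, v₄] ![v₂, v₃, v₄, v₄, u₁, u₂, u₃, u₄]
    ?_ ?_ hv₁ ⟨0, rfl⟩ ⟨3, rfl⟩ ⟨4, rfl⟩
    ![{0}ᶜ, {1}ᶜ, {2}ᶜ, {3}ᶜ, {4, 6}ᶜ, {5, 7}ᶜ, {4, 6}ᶜ, {5, 7}ᶜ] (by decide) ?_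
    ![11, 11, 11, 11, 12, 12, 12, 12] ?_ (by decide)
    (choosableOn_four_cycle (fun _ _ => edgeConflict.symm) ?_ ?_)
  · simp [Fin.forall_fin_succ, *]
  · simp [Fin.forall_fin_succ, *]
    grind
  · simp [Fin.forall_fin_succ, *]
  · simp [Fin.forall_fin_succ, *]
  · change ¬ edgeConflict G s(v₁, u₁) s(v₃, u₃)
    rw [edgeConflict_mk]
    grind [G.adj_comm]
  · change ¬ edgeConflict G s(v₂, u₂) s(v₄, u₄)
    rw [edgeConflict_mk]
    grind [G.adj_comm]

/-- A critical graph has no 5-cycle. -/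
theorem no_five_cycle (h : IsCritical G L) {v₁ v₂ v₃ v₄ v₅ : V} (h₁₂ : G.Adj v₁ v₂)
    (h₂₃ : G.Adj v₂ v₃) (h₃₄ : G.Adj v₃ v₄) (h₄₅ : G.Adj v₄ v₅) (h₅₁ : G.Adj v₅ v₁)
    (h₁₃ : v₁ ≠ v₃) (h₂₄ : v₂ ≠ v₄) (h₃₅ : v₃ ≠ v₅) (h₄₁ : v₄ ≠ v₁) (h₅₂ : v₅ ≠ v₂) :
    False := by
  obtain ⟨u₁, d₁₂, d₁₅, _, hv₁⟩ := h.exists_third h₁₂ h₅₁.symm h₅₂.symm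
  obtain ⟨u₂, d₂₁, d₂₃, _, hv₂⟩ := h.exists_third h₁₂.symm h₂₃ h₁₃
  obtain ⟨u₃, d₃₂, d₃₄, _, hv₃⟩ := h.exists_third h₂₃.symm h₃₄ h₂₄
  obtain ⟨u₄, d₄₃, d₄₅, _, hv₄⟩ := h.exists_third h₃₄.symm h₄₅ h₃₅
  obtain ⟨u₅, d₅₄, d₅₁, _, hv₅⟩ := h.exists_third h₄₅.symm h₅₁ h₄₁
  have k₁ : G.Adj v₁ u₁ := by simp [hv₁]
  have k₂ : G.Adj v₂ u₂ := by simp [hv₂]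
  have k₃ : G.Adj v₃ u₃ := by simp [hv₃]
  have k₄ : G.Adj v₄ u₄ := by simp [hv₄]
  have k₅ : G.Adj v₅ u₅ := by simp [hv₅]
  have n₁₃ : ¬ G.Adj v₁ v₃ := fun h₁₃ => h.no_triangle h₁₂ h₂₃ h₁₃.symm
  have n₂₄ : ¬ G.Adj v₂ v₄ := fun h₂₄ => h.no_triangle h₂₃ h₃₄ h₂₄.symm
  have n₃₅ : ¬ G.Adj v₃ v₅ := fun h₃₅ => h.no_triangle h₃₄ h₄₅ h₃₅.symm
  have n₄₁ : ¬ G.Adj v₄ v₁ := fun h₄₁ => h.no_triangle h₄₅ h₅₁ h₄₁.symm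
  have n₅₂ : ¬ G.Adj v₅ v₂ := fun h₅₂ => h.no_triangle h₅₁ h₁₂ h₅₂.symm
  have d₁₃ : u₁ ≠ u₃ := fun hu => h.no_four_cycle h₁₂ h₂₃ k₃ (hu ▸ k₁.symm) h₁₃ d₃₂.symm
  have d₂₄ : u₂ ≠ u₄ := fun hu => h.no_four_cycle h₂₃ h₃₄ k₄ (hu ▸ k₂.symm) h₂₄ d₄₃.symm
  have d₃₅ : u₃ ≠ u₅ := fun hu => h.no_four_cycle h₃₄ h₄₅ k₅ (hu ▸ k₃.symm) h₃₅ d₅₄.symm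
  have d₄₁ : u₄ ≠ u₁ := fun hu => h.no_four_cycle h₄₅ h₅₁ k₁ (hu ▸ k₄.symm) h₄₁ d₁₅.symm
  have d₅₂ : u₅ ≠ u₂ := fun hu => h.no_four_cycle h₅₁ h₁₂ k₂ (hu ▸ k₅.symm) h₅₂ d₂₁.symm
  have := h₁₂.ne
  have := h₂₃.ne
  have := h₃₄.ne
  have := h₄₅.ne
  have := h₅₁.ne
  have := h₁₂.symm
  have := h₂₃.symm
  have := h₃₄.symm
  have := h₄₅.symm
  have := h₅₁.symm
  have := h.card_conflicts_le h₁₂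
  have := h.card_conflicts_le h₂₃
  have := h.card_conflicts_le h₃₄
  have := h.card_conflicts_le h₄₅
  have := h.card_conflicts_le h₅₁.symm
  have := h.card_conflicts_le k₁
  have := h.card_conflicts_le k₂
  have := h.card_conflicts_le k₃
  have := h.card_conflicts_le k₄
  have := h.card_conflicts_le k₅
  have hinj : ∀ i j : Fin 10, i < j → s(![v₁, v₂, v₃, v₄, v₁, v₁, v₂, v₃, v₄, v₅] i,
      ![v₂, v₃, v₄, v₅, v₅, u₁, u₂, u₃, u₄, u₅] i) ≠ s(![v₁, v₂, v₃, v₄, v₁, v₁, v₂, v₃, v₄, v₅] j,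
      ![v₂, v₃, v₄, v₅, v₅, u₁, u₂, u₃, u₄, u₅] j) := by
    simp [Fin.forall_fin_succ, *]
    grind
  have h08 : ¬ edgeConflict G s(v₁, v₂) s(v₄, u₄) := by
    rw [edgeConflict_mk]
    grind [G.adj_comm]
  have h19 : ¬ edgeConflict G s(v₂, v₃) s(v₅, u₅) := by
    rw [edgeConflict_mk]
    grind [G.adj_comm]
  have h25 : ¬ edgeConflict G s(v₃, v₄) s(v₁, u₁) := by
    rw [edgeConflict_mk]
    grind [G.adj_comm]
  have h36 : ¬ edgeConflict G s(v₄, v₅) s(v₂, u₂) := by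
    rw [edgeConflict_mk]
    grind [G.adj_comm]
  have h47 : ¬ edgeConflict G s(v₁, v₅) s(v₃, u₃) := by
    rw [edgeConflict_mk]
    grind [G.adj_comm]
  by_cases k₁₃ : G.Adj u₁ u₃
  · have := k₁₃.symm
    refine h.not_choosableOn_fin ![v₁, v₂, v₃, v₄, v₁, v₁, v₂, v₃, v₄, v₅]
      ![v₂, v₃, v₄, v₅, v₅, u₁, u₂, u₃, u₄, u₅] ?_ hinj hv₁ ⟨0, rfl⟩ ⟨4, rfl⟩ ⟨5, rfl⟩
      ![{0, 8}ᶜ, {1, 9}ᶜ, {2, 5}ᶜ, {3, 6}ᶜ, {4, 7}ᶜ, {2, 5, 8}ᶜ, {3, 6, 8, 9}ᶜ, {4, 7, 9}ᶜ,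
        {0, 5, 6, 8}ᶜ, {1, 6, 7, 9}ᶜ] (by decide) ?_ (fun _ => 12) ?_ (by decide)
      (choosableOn_five_cycle' (fun _ _ => edgeConflict.symm) h08 h19 h36 h25 h47)
    · simp [Fin.forall_fin_succ, *]
    · simp [Fin.forall_fin_succ, *]
    · simp [Fin.forall_fin_succ, *]
  · refine h.not_choosableOn_fin ![v₁, v₂, v₃, v₄, v₁, v₁, v₂, v₃, v₄, v₅]
      ![v₂, v₃, v₄, v₅, v₅, u₁, u₂, u₃, u₄, u₅] ?_ hinj hv₁ ⟨0, rfl⟩ ⟨4, rfl⟩ ⟨5, rfl⟩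
      ![{0, 8}ᶜ, {1, 9}ᶜ, {2, 5}ᶜ, {3, 6}ᶜ, {4, 7}ᶜ, {2, 5, 7, 8}ᶜ, {3, 6, 8, 9}ᶜ, {4, 5, 7, 9}ᶜ,
        {0, 5, 6, 8}ᶜ, {1, 6, 7, 9}ᶜ] (by decide) ?_ (fun _ => 12) ?_ (by decide)
      (choosableOn_five_cycle (fun _ _ => edgeConflict.symm) h08 h19 h36 h25 h47 ?_)
    · simp [Fin.forall_fin_succ, *]
    · simp [Fin.forall_fin_succ, *]
    · simp [Fin.forall_fin_succ, *]
    · change ¬ edgeConflict G s(v₁, u₁) s(v₃, u₃)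
      rw [edgeConflict_mk]
      grind [G.adj_comm]

end IsCritical

/-- If `G` is subcubic, `L` is a 10-edge list assignment, `G` has no strong `L`-edge-coloring
but every proper subgraph of `G` has one, then `G` has no cycle of length at most 5. -/
theorem minimal_counterexample_girth_ge_six {V : Type*} [Fintype V] [DecidableEq V]
    (G : SimpleGraph V) [DecidableRel G.Adj] (hsub : ∀ v, G.degree v ≤ 3)
    (L : Sym2 V → Finset ℕ) (hL : ∀ e ∈ G.edgeSet, 10 ≤ (L e).card)
    (hno : ¬ ∃ φ, IsStrongListColoring G L φ)
    (hmin : ∀ H : SimpleGraph V, H ≤ G → H ≠ G → ∃ φ, IsStrongListColoring H L φ) :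
    ∀ (v : V) (c : G.Walk v v), c.IsCycle → 6 ≤ c.length := by
  intro v c hc
  have h : IsCritical G L := ⟨hsub, hL, hno, hmin⟩
  have hlen := hc.three_le_length
  have hnodup := hc.support_nodup
  by_contra! hlt
  cases c with
  | nil => simp at hlen
  | cons h₁ c =>
  cases c with
  | nil => simp at hlen
  | cons h₂ c =>
  cases c with
  | nil => simp at hlen
  | cons h₃ c =>
  cases c with
  | nil => exact h.no_triangle h₁ h₂ h₃
  | cons h₄ c =>
  cases c with
  | nil =>
    simp at hnodup
    exact h.no_four_cycle h₁ h₂ h₃ h₄ (by grind) (by grind)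
  | cons h₅ c =>
  cases c with
  | nil =>
    simp at hnodup
    exact h.no_five_cycle h₁ h₂ h₃ h₄ h₅ (by grind) (by grind) (by grind) (by grind) (by grind)
  | cons h₆ c =>
    simp at hlt
    omega
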